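/- arXiv:2303.03840 — 2 statements merged into one kernel-verified Lean document; each statement's English description precedes it below -/
import Mathlib

section
/- Let Q, P, and P_low be probability measures on X, let c : X → Y be the true labeling function, and let f_low, f : X → Y be classifiers such that all relevant disagreement sets are measurable. Then ε_Q(f_low) ≤ ε_Q(f) + ε_{P_low}(f_low, f) + |ε_P(f_low, f) − ε_Q(f_low, f)| + |ε_{P_low}(f_low, f) − ε_P(f_low, f)|. -/
open MeasureTheory

/-- The disagreement error of two functions under a measure `μ`,
`ε_μ(h, h') = μ {x | h x ≠ h' x}` (as a real number). -/
noncomputable def disErr {X Y : Type*} [MeasurableSpace X]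
    (μ : Measure X) (h h' : X → Y) : ℝ :=
  (μ {x | h x ≠ h' x}).toReal

/-- The disagreement error satisfies the triangle inequality. -/
theorem disErr_triangle {X Y : Type*} [MeasurableSpace X] (μ : Measure X) [IsFiniteMeasure μ]
    (h₁ h₂ h₃ : X → Y) : disErr μ h₁ h₃ ≤ disErr μ h₁ h₂ + disErr μ h₂ h₃ := by
  have hsub : {x | h₁ x ≠ h₃ x} ⊆ {x | h₁ x ≠ h₂ x} ∪ {x | h₂ x ≠ h₃ x} := by
    intro x hx
    by_contra hc
    simp only [Set.mem_union, Set.mem_ofPred_eq, not_or, not_not] at hc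
    exact hx (hc.1.trans hc.2)
  exact (measureReal_mono hsub).trans (measureReal_union_le _ _)

/-- the deterministic error decomposition
`ε_Q(f_low) ≤ ε_Q(f) + ε_{P_low}(f_low, f) + |ε_P(f_low, f) − ε_Q(f_low, f)|
  + |ε_{P_low}(f_low, f) − ε_P(f_low, f)|`,
where errors of a single classifier are measured against the true labeling function `c`. -/
theorem error_decomposition {X Y : Type*} [MeasurableSpace X]
    (Q P Plow : Measure X)
    [IsProbabilityMeasure Q] [IsProbabilityMeasure P] [IsProbabilityMeasure Plow]
    (c flow f : X → Y)
    (hm1 : MeasurableSet {x | flow x ≠ c x})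
    (hm2 : MeasurableSet {x | f x ≠ c x})
    (hm3 : MeasurableSet {x | flow x ≠ f x}) :
    disErr Q flow c ≤
      disErr Q f c + disErr Plow flow f
        + |disErr P flow f - disErr Q flow f|
        + |disErr Plow flow f - disErr P flow f| := by
  have h := disErr_triangle Q flow f c
  have h₁ := neg_abs_le (disErr P flow f - disErr Q flow f)
  have h₂ := neg_abs_le (disErr Plow flow f - disErr P flow f)
  linarith
end

section
/- Let Q be a probability measure on X, c : X → Y the true labeling function, H a finite nonempty set of functions from X to Y containing the classifiers f_low and f, and let P_low be a probability measure on X; assume all relevant disagreement sets are measurable. Let X₁, …, X_m be i.i.d. samples from Q and let P̂ denote their empirical measure. Then for any δ ∈ (0,1), with probability at least 1 − δ over the draw of the samples: ε_Q(f_low) ≤ ε_Q(f) + ε_{P_low}(f_low, f) + sup_{h, h' ∈ H} |ε_{P_low}(h, h') − ε_{P̂}(h, h')| + √((2 ln|H| + ln(2/δ))/(2m)). -/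
open MeasureTheory

open ProbabilityTheory in
/-- **Hoeffding's inequality for frequencies**: the empirical frequency of a measurable set `A` in
`m` i.i.d. samples falls below `Q A` by at least `t` with probability at most
`exp (-2 * m * t ^ 2)`. -/
lemma measureReal_pi_sub_frequency_ge_le {X : Type*} [MeasurableSpace X] (Q : Measure X)
    [IsProbabilityMeasure Q] {A : Set X} [DecidablePred (· ∈ A)] (hA : MeasurableSet A) {m : ℕ}
    (hm : 0 < m) {t : ℝ} (ht : 0 ≤ t) :
    (Measure.pi fun _ : Fin m => Q).real
        {ω | t ≤ Q.real A - ((Finset.univ.filter fun i => ω i ∈ A).card : ℝ) / m} ≤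
      Real.exp (-2 * m * t ^ 2) := by
  have hm' : (0 : ℝ) < m := by exact_mod_cast hm
  set g : X → ℝ := fun x => -A.indicator 1 x with hg
  have hgm : Measurable g := (measurable_one.indicator hA).neg
  have hint : ∫ x, g x ∂Q = -Q.real A := by
    rw [hg, integral_neg, integral_indicator_one hA]
  have hbound : ∀ᵐ x ∂Q, g x ∈ Set.Icc (-1 : ℝ) 0 := by
    refine ae_of_all _ fun x => ?_
    by_cases hx : x ∈ A <;> simp [hg, hx]
  have hsub := hasSubgaussianMGF_of_mem_Icc hgm.aemeasurable hbound
  have hsub' : ∀ i ∈ (Finset.univ : Finset (Fin m)),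
      HasSubgaussianMGF (fun ω : Fin m → X => g (ω i) - ∫ x, g x ∂Q)
        ((‖(0 : ℝ) - -1‖₊ / 2) ^ 2) (Measure.pi fun _ : Fin m => Q) := by
    intro i _
    refine HasSubgaussianMGF.of_map (Y := fun ω : Fin m → X => ω i)
      (X := fun x => g x - ∫ x, g x ∂Q) (measurable_pi_apply i).aemeasurable ?_
    rwa [(measurePreserving_eval (fun _ : Fin m => Q) i).map_eq]
  have hindep : iIndepFun (fun (i : Fin m) (ω : Fin m → X) => g (ω i) - ∫ x, g x ∂Q)
      (Measure.pi fun _ : Fin m => Q) :=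
    iIndepFun_pi (X := fun _ x => g x - ∫ x, g x ∂Q)
      fun _ => (hgm.sub_const _).aemeasurable
  have hoeff := HasSubgaussianMGF.measure_sum_ge_le_of_iIndepFun hindep hsub'
    (mul_nonneg hm'.le ht)
  have hset : {ω : Fin m → X |
      t ≤ Q.real A - ((Finset.univ.filter fun i => ω i ∈ A).card : ℝ) / m} =
      {ω | m * t ≤ ∑ i, (g (ω i) - ∫ x, g x ∂Q)} := by
    ext ω
    have hsum : ∑ i, (g (ω i) - ∫ x, g x ∂Q) =
        m * (Q.real A - ((Finset.univ.filter fun i => ω i ∈ A).card : ℝ) / m) := by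
      have hcard : ∑ i, A.indicator (1 : X → ℝ) (ω i) =
          ((Finset.univ.filter fun i => ω i ∈ A).card : ℝ) := by
        simp [Set.indicator_apply]
      rw [hint]
      simp only [hg, Finset.sum_sub_distrib, Finset.sum_neg_distrib, hcard,
        Finset.sum_const, Finset.card_univ, Fintype.card_fin, nsmul_eq_mul]
      field_simp
      ring
    simp only [Set.mem_ofPred_eq, hsum, mul_le_mul_iff_right₀ hm']
  rw [hset]
  refine hoeff.trans (Real.exp_le_exp.mpr (le_of_eq ?_))
  simp only [Finset.sum_const, Finset.card_univ, Fintype.card_fin, nsmul_eq_mul]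
  push_cast
  norm_num
  field_simp
  ring

/-- the covariate-shift generalization bound.  With probability at least
`1 − δ` over the draw of `m` i.i.d. samples from `Q`,
`ε_Q(f_low) ≤ ε_Q(f) + ε_{P_low}(f_low, f)
  + sup_{h, h' ∈ H} |ε_{P_low}(h, h') − ε_{P̂}(h, h')|
  + √((2 ln|H| + ln(2/δ)) / (2m))`,
where `P̂` is the empirical measure of the samples (so `ε_{P̂}(h, h')` is the empirical
disagreement frequency), and errors of single classifiers are against the true labels `c`. -/
theorem covariate_shift_bound {X Y : Type*} [MeasurableSpace X]
    [DecidableEq Y]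
    (Q Plow : Measure X) [IsProbabilityMeasure Q] [IsProbabilityMeasure Plow]
    (c : X → Y) (H : Finset (X → Y)) (flow f : X → Y)
    (hflow : flow ∈ H) (hf : f ∈ H)
    (hmeasc : ∀ h ∈ H, MeasurableSet {x | h x ≠ c x})
    (hmeas : ∀ h ∈ H, ∀ h' ∈ H, MeasurableSet {x | h x ≠ h' x})
    (m : ℕ) (hm : 0 < m) (δ : ℝ) (hδ0 : 0 < δ) (hδ1 : δ < 1) :
    ENNReal.ofReal (1 - δ) ≤
      (Measure.pi fun _ : Fin m => Q)
        {ω : Fin m → X |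
          (Q {x | flow x ≠ c x}).toReal ≤
            (Q {x | f x ≠ c x}).toReal
            + (Plow {x | flow x ≠ f x}).toReal
            + sSup {d : ℝ | ∃ h ∈ H, ∃ h' ∈ H,
                d = |(Plow {x | h x ≠ h' x}).toReal
                      - ((Finset.univ.filter fun i => h (ω i) ≠ h' (ω i)).card : ℝ) / m|}
            + Real.sqrt ((2 * Real.log H.card + Real.log (2 / δ)) / (2 * m))} := by
  have hm' : (0 : ℝ) < m := by exact_mod_cast hm
  have hH : (1 : ℝ) ≤ H.card := by
    exact_mod_cast Finset.card_pos.mpr ⟨flow, hflow⟩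
  have hlogH : 0 ≤ Real.log H.card := Real.log_nonneg hH
  have hlogδ : 0 ≤ Real.log (2 / δ) :=
    Real.log_nonneg (by rw [le_div_iff₀ hδ0]; linarith)
  set t := Real.sqrt ((2 * Real.log H.card + Real.log (2 / δ)) / (2 * m)) with ht
  have hexp : Real.exp (-2 * m * t ^ 2) ≤ δ := by
    rw [ht, Real.sq_sqrt (by positivity), ← Real.le_log_iff_exp_le hδ0]
    have hval : -2 * m * ((2 * Real.log H.card + Real.log (2 / δ)) / (2 * m)) =
        -(2 * Real.log H.card + Real.log (2 / δ)) := by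
      field_simp
    rw [hval, Real.log_div two_ne_zero hδ0.ne']
    linarith [Real.log_nonneg one_le_two]
  set P := Measure.pi fun _ : Fin m => Q with hP
  set A := {x | flow x ≠ f x} with hA
  classical
  set bad : Set (Fin m → X) :=
    {ω | t ≤ Q.real A - ((Finset.univ.filter fun i => ω i ∈ A).card : ℝ) / m}
  have hbad : P bad ≤ ENNReal.ofReal δ :=
    (ENNReal.le_ofReal_iff_toReal_le (measure_ne_top _ _) hδ0.le).mpr <|
      (measureReal_pi_sub_frequency_ge_le Q (hmeas flow hflow f hf) hm
        (Real.sqrt_nonneg _)).trans hexp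
  have hgood : ENNReal.ofReal (1 - δ) ≤ P badᶜ := by
    rw [ENNReal.ofReal_sub _ hδ0.le, ENNReal.ofReal_one, tsub_le_iff_right]
    calc (1 : ENNReal) = P (badᶜ ∪ bad) := by rw [Set.compl_union_self, measure_univ]
      _ ≤ P badᶜ + P bad := measure_union_le _ _
      _ ≤ P badᶜ + ENNReal.ofReal δ := by gcongr
  refine hgood.trans (measure_mono fun ω hω => ?_)
  have hdev : Q.real A - ((Finset.univ.filter fun i => ω i ∈ A).card : ℝ) / m < t :=
    not_le.mp hω
  have htri : Q.real {x | flow x ≠ c x} ≤ Q.real {x | f x ≠ c x} + Q.real A := by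
    refine (measureReal_mono fun x hx => ?_).trans (measureReal_union_le _ _)
    by_cases hfx : f x = c x
    · exact Or.inr fun h => hx (h.trans hfx)
    · exact Or.inl hfx
  have hbdd : BddAbove {d : ℝ | ∃ h ∈ H, ∃ h' ∈ H,
      d = |(Plow {x | h x ≠ h' x}).toReal
            - ((Finset.univ.filter fun i => h (ω i) ≠ h' (ω i)).card : ℝ) / m|} := by
    refine ((H ×ˢ H).finite_toSet.image fun p : (X → Y) × (X → Y) =>
      |(Plow {x | p.1 x ≠ p.2 x}).toReal
        - ((Finset.univ.filter fun i => p.1 (ω i) ≠ p.2 (ω i)).card : ℝ) / m|).bddAbove.mono ?_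
    rintro d ⟨h, hh, h', hh', rfl⟩
    exact ⟨(h, h'), by simp [hh, hh'], rfl⟩
  have hsup := (neg_abs_le _).trans' (neg_le_neg (le_csSup hbdd ⟨flow, hflow, f, hf, rfl⟩))
  have hfreq : (Finset.univ.filter fun i => ω i ∈ A) =
      Finset.univ.filter fun i => flow (ω i) ≠ f (ω i) := by
    ext i
    simp [hA]
  rw [hfreq] at hdev
  simp only [Measure.real] at htri hdev
  rw [Set.mem_ofPred_eq]
  linarith
end
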